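/- Let n ≥ 2p−1 and let α_i, β_i be the operators on V^⊗n defined in the context. For all 1 ≤ i, j ≤ n−2p+2 with |i−j| < p, one has α_i∘α_j = α_j∘α_i = 0 and β_i∘β_j = β_j∘β_i = 0. -/

import Mathlib

noncomputable section

/-- The quantum integer `[n] = (q^n - q^{-n})/(q - q⁻¹)`. -/
def qint (q : ℂ) (n : ℤ) : ℂ := (q ^ n - q ^ (-n)) / (q - q⁻¹)

/-- The quantum factorial `[n]! = [1][2]⋯[n]`, with `[0]! = 1`. -/
def qfact (q : ℂ) (n : ℕ) : ℂ := ∏ m ∈ Finset.range n, qint q ((m : ℤ) + 1)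

/-- Binary strings of length `z`, indexing the standard basis of `V^{⊗z}` for `V = ℂ²`:
value `1` at a position means `ν₁` there, value `0` means `ν₀`. -/
abbrev Str (z : ℕ) := Fin z → Fin 2

/-- `V^{⊗z}`, modelled by coordinates with respect to the standard basis of tensors of
`ν₀`'s and `ν₁`'s. -/
abbrev Vz (z : ℕ) := Str z → ℂ

/-- The basis vector `ρ_{i₁,…,i_k,z}` of `V^{⊗z}` having `ν₁` exactly at the positions in `S`
and `ν₀` elsewhere. -/
def rho (z : ℕ) (S : Finset (Fin z)) : Vz z :=
  fun t => if t = (fun j => if j ∈ S then 1 else 0) then 1 else 0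

/-- `x_{0,z} = ν₀^{⊗z}`. -/
def x0 (z : ℕ) : Vz z := rho z ∅

/-- `x_{z,z} = ν₁^{⊗z}`. -/
def xtop (z : ℕ) : Vz z := rho z Finset.univ

/-- The set of positions of a basis string carrying `ν₁`. -/
def onesOf {z : ℕ} (s : Str z) : Finset (Fin z) := Finset.univ.filter fun j => s j = 1

/-- `i₁ + ⋯ + i_k`, the sum of the (1-indexed) positions in `S`. -/
def posSum {z : ℕ} (S : Finset (Fin z)) : ℤ := ∑ j ∈ S, (((j : ℕ) : ℤ) + 1)

/-- The `K`-weight exponent of a basis vector of `V`: `Kν₀ = qν₀`, `Kν₁ = q⁻¹ν₁`. -/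
def kwt (v : Fin 2) : ℤ := if v = 0 then 1 else -1

/-- Matrix of `E_z = Σᵢ 1^{⊗(i-1)} ⊗ E ⊗ K^{⊗(z-i)}` on `V^{⊗z}`. -/
def Emat (q : ℂ) (z : ℕ) : Matrix (Str z) (Str z) ℂ := fun t s =>
  ∑ i : Fin z,
    if s i = 1 ∧ t = Function.update s i 0 then
      q ^ (∑ j ∈ Finset.univ.filter (fun j => i < j), kwt (s j)) else 0

/-- Matrix of `F_z = Σᵢ (K⁻¹)^{⊗(i-1)} ⊗ F ⊗ 1^{⊗(z-i)}` on `V^{⊗z}`. -/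
def Fmat (q : ℂ) (z : ℕ) : Matrix (Str z) (Str z) ℂ := fun t s =>
  ∑ i : Fin z,
    if s i = 0 ∧ t = Function.update s i 1 then
      q ^ (-∑ j ∈ Finset.univ.filter (fun j => j < i), kwt (s j)) else 0

/-- `E_z` as a linear operator on `V^{⊗z}`. -/
def EOp (q : ℂ) (z : ℕ) : Module.End ℂ (Vz z) := (Emat q z).mulVecLin

/-- `F_z` as a linear operator on `V^{⊗z}`. -/
def FOp (q : ℂ) (z : ℕ) : Module.End ℂ (Vz z) := (Fmat q z).mulVecLin

/-- Matrix of the map `α : V^{⊗(2p-1)} → V^{⊗(2p-1)}`, with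
`α(ρ_{i₁,…,i_k,2p-1}) = q^{k(2p-1) - (k²-k)/2 - Σᵢ iⱼ}·[k]!·E_{2p-1}^{p-k-1} x_{2p-1,2p-1}`
for `k ≤ p-1`, and `α(ρ_{i₁,…,i_k,2p-1}) = 0` for `k ≥ p`. -/
def alphaMat (q : ℂ) (p : ℕ) : Matrix (Str (2 * p - 1)) (Str (2 * p - 1)) ℂ := fun t s =>
  let k := (onesOf s).card
  if k < p then
    (q ^ ((k : ℤ) * ((2 * p - 1 : ℕ) : ℤ) - ((k : ℤ) ^ 2 - (k : ℤ)) / 2 - posSum (onesOf s))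
        * qfact q k)
      * ((EOp q (2 * p - 1) ^ (p - 1 - k)) (xtop (2 * p - 1)) t)
  else 0

/-- Matrix of the map `β : V^{⊗(2p-1)} → V^{⊗(2p-1)}`, with
`β(ρ_{i₁,…,i_k,2p-1}) = q^{k(2p-1) - (k²-k)/2 - Σᵢ iⱼ}·[2p-1-k]!·F_{2p-1}^{k-p} x_{0,2p-1}`
for `k ≥ p`, and `β(ρ_{i₁,…,i_k,2p-1}) = 0` for `k ≤ p-1`. -/
def betaMat (q : ℂ) (p : ℕ) : Matrix (Str (2 * p - 1)) (Str (2 * p - 1)) ℂ := fun t s =>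
  let k := (onesOf s).card
  if p ≤ k then
    (q ^ ((k : ℤ) * ((2 * p - 1 : ℕ) : ℤ) - ((k : ℤ) ^ 2 - (k : ℤ)) / 2 - posSum (onesOf s))
        * qfact q (2 * p - 1 - k))
      * ((FOp q (2 * p - 1) ^ (k - p)) (x0 (2 * p - 1)) t)
  else 0

/-- The operator `α` on `V^{⊗(2p-1)}`. -/
def alphaOp (q : ℂ) (p : ℕ) : Module.End ℂ (Vz (2 * p - 1)) := (alphaMat q p).mulVecLin

/-- The operator `β` on `V^{⊗(2p-1)}`. -/
def betaOp (q : ℂ) (p : ℕ) : Module.End ℂ (Vz (2 * p - 1)) := (betaMat q p).mulVecLin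

/-- `1^{⊗a} ⊗ M ⊗ 1^{⊗(n-a-c)}`: the amplification of a matrix `M` acting on `c` tensor
factors to `V^{⊗n}`, placed on the factor positions `a+1, …, a+c` (1-indexed). -/
def ampMat (n a c : ℕ) (h : a + c ≤ n) (M : Matrix (Str c) (Str c) ℂ) :
    Matrix (Str n) (Str n) ℂ := fun t s =>
  if ∀ j : Fin n, ((j : ℕ) < a ∨ a + c ≤ (j : ℕ)) → t j = s j then
    M (fun j => t ⟨a + (j : ℕ), by have := j.isLt; omega⟩)
      (fun j => s ⟨a + (j : ℕ), by have := j.isLt; omega⟩)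
  else 0

/-- `α_i = 1^{⊗(i-1)} ⊗ α ⊗ 1^{⊗(n-2p+2-i)}` on `V^{⊗n}` (with `i` 1-indexed). -/
def alphaOpAt (q : ℂ) (p n i : ℕ) (h : (i - 1) + (2 * p - 1) ≤ n) : Module.End ℂ (Vz n) :=
  (ampMat n (i - 1) (2 * p - 1) h (alphaMat q p)).mulVecLin

/-- `β_i = 1^{⊗(i-1)} ⊗ β ⊗ 1^{⊗(n-2p+2-i)}` on `V^{⊗n}` (with `i` 1-indexed). -/
def betaOpAt (q : ℂ) (p n i : ℕ) (h : (i - 1) + (2 * p - 1) ≤ n) : Module.End ℂ (Vz n) :=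
  (ampMat n (i - 1) (2 * p - 1) h (betaMat q p)).mulVecLin

/-- Matrix of `∪` applied at the (0-indexed) positions `i, i+1` of `N = M + 2` strands:
`∪(ν₀⊗ν₀) = ∪(ν₁⊗ν₁) = 0`, `∪(ν₁⊗ν₀) = 1`, `∪(ν₀⊗ν₁) = -q`. -/
def cupMat (q : ℂ) (N M i : ℕ) (h : N = M + 2) (hi : i + 1 < N) :
    Matrix (Str M) (Str N) ℂ := fun t s =>
  if ∀ j : Fin M,
      t j = s ⟨if (j : ℕ) < i then (j : ℕ) else (j : ℕ) + 2, by
        have := j.isLt; split <;> omega⟩ then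
    (if s ⟨i, by omega⟩ = 1 ∧ s ⟨i + 1, hi⟩ = 0 then 1
     else if s ⟨i, by omega⟩ = 0 ∧ s ⟨i + 1, hi⟩ = 1 then -q
     else 0)
  else 0

/-- Matrix of `∩` inserted at the (0-indexed) positions `i, i+1` of `N = M + 2` strands:
`∩(1) = q⁻¹ ν₁⊗ν₀ - ν₀⊗ν₁`. -/
def capMat (q : ℂ) (N M i : ℕ) (h : N = M + 2) (hi : i + 1 < N) :
    Matrix (Str N) (Str M) ℂ := fun t s =>
  if ∀ j : Fin M,
      s j = t ⟨if (j : ℕ) < i then (j : ℕ) else (j : ℕ) + 2, by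
        have := j.isLt; split <;> omega⟩ then
    (if t ⟨i, by omega⟩ = 1 ∧ t ⟨i + 1, hi⟩ = 0 then q⁻¹
     else if t ⟨i, by omega⟩ = 0 ∧ t ⟨i + 1, hi⟩ = 1 then -1
     else 0)
  else 0

/-- `∪_{i+1} : V^{⊗N} → V^{⊗M}`, `N = M + 2` (here `i` is the 0-indexed position). -/
def cupOp (q : ℂ) (N M i : ℕ) (h : N = M + 2) (hi : i + 1 < N) : Vz N →ₗ[ℂ] Vz M :=
  (cupMat q N M i h hi).mulVecLin

/-- `∩_{i+1} : V^{⊗M} → V^{⊗N}`, `N = M + 2` (here `i` is the 0-indexed position). -/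
def capOp (q : ℂ) (N M i : ℕ) (h : N = M + 2) (hi : i + 1 < N) : Vz M →ₗ[ℂ] Vz N :=
  (capMat q N M i h hi).mulVecLin

/-- Matrix of the Jones–Wenzl-type map `G_n` on `V^{⊗n}`:
`G_n(ρ_{i₁,…,i_k,n}) = q^{kn - (k²-k)/2 - Σ iⱼ}·([n-k]!/[n]!)·F_n^k x_{0,n}`. -/
def jwMat (q : ℂ) (n : ℕ) : Matrix (Str n) (Str n) ℂ := fun t s =>
  let k := (onesOf s).card
  (q ^ ((k : ℤ) * (n : ℤ) - ((k : ℤ) ^ 2 - (k : ℤ)) / 2 - posSum (onesOf s))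
      * (qfact q (n - k) / qfact q n))
    * ((FOp q n ^ k) (x0 n) t)

/-- The Jones–Wenzl-type map `G_n` on `V^{⊗n}`. -/
def jwOp (q : ℂ) (n : ℕ) : Module.End ℂ (Vz n) := (jwMat q n).mulVecLin

/-- `v ⊗ ν_a : V^{⊗z} ⊗ V → V^{⊗(z+1)}` (appending a basis vector of `V` on the right). -/
def appendR {z : ℕ} (v : Vz z) (a : Fin 2) : Vz (z + 1) :=
  fun t => if t (Fin.last z) = a then v (fun j => t j.castSucc) else 0

/-- `ν_a ⊗ v : V ⊗ V^{⊗z} → V^{⊗(z+1)}` (appending a basis vector of `V` on the left). -/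
def appendL {z : ℕ} (a : Fin 2) (v : Vz z) : Vz (z + 1) :=
  fun t => if t 0 = a then v (fun j => t j.succ) else 0

/-- `ξ_{n,z} = Σ_{1 ≤ i₁ < ⋯ < i_n ≤ z} q^{-2(i₁+⋯+i_n)}`. -/
def xiSum (q : ℂ) (n z : ℕ) : ℂ :=
  ∑ S ∈ Finset.powersetCard n (Finset.univ : Finset (Fin z)), q ^ (-2 * posSum S)

/-- In `∏ (1 + xʲ X)` over `p` consecutive exponents, with `x` a primitive `p`-th root of unity,
only the extreme coefficients survive. -/
theorem coeff_prod_one_add_eq_zero {x : ℂ} {p : ℕ} (hx : IsPrimitiveRoot x p) (lo k : ℕ)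
    (hk0 : k ≠ 0) (hkp : k < p) :
    (∏ j ∈ Finset.Ico lo (lo + p),
      (1 + Polynomial.C (x ^ j) * Polynomial.X)).coeff k = 0 := by
  set P := ∏ j ∈ Finset.Ico lo (lo + p), (1 + Polynomial.C (x ^ j) * Polynomial.X) with hP
  have hcomp : P.comp (Polynomial.C x * Polynomial.X) = P := by
    have h1 : P.comp (Polynomial.C x * Polynomial.X) =
        ∏ j ∈ Finset.Ico lo (lo + p), (1 + Polynomial.C (x ^ (j + 1)) * Polynomial.X) := by
      rw [hP, Polynomial.prod_comp]
      refine Finset.prod_congr rfl fun j _ => ?_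
      simp [pow_succ, mul_assoc]
    rw [h1, Finset.prod_Ico_add' (fun j => 1 + Polynomial.C (x ^ j) * Polynomial.X) lo (lo + p) 1,
      hP]
    have hlt : lo < lo + p := by omega
    rw [Finset.prod_eq_prod_Ico_succ_bot hlt, add_right_comm lo p 1,
      show lo + 1 + p = lo + p + 1 by omega, Finset.prod_Ico_succ_top (by omega), pow_add,
      hx.pow_eq_one, mul_one, mul_comm]
  have hc := Polynomial.comp_C_mul_X_coeff (p := P) (r := x) (n := k)
  rw [hcomp] at hc
  have hne : x ^ k ≠ 1 := hx.pow_ne_one_of_pos_of_lt hk0 hkp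
  have : P.coeff k * (x ^ k - 1) = 0 := by linear_combination -hc
  exact (mul_eq_zero.mp this).resolve_right (sub_ne_zero.mpr hne)

/-- The Gaussian binomial `[L choose r]` vanishes at a primitive `p`-th root of unity when
`p ≤ L`, `r < p` and `L - r < p`. -/
theorem sum_powersetCard_Ico_pow_eq_zero {x : ℂ} {p : ℕ} (hx : IsPrimitiveRoot x p)
    {lo L r : ℕ} (hpL : p ≤ L) (hr : r < p) (hL : L < r + p) :
    ∑ S ∈ Finset.powersetCard r (Finset.Ico lo (lo + L)), x ^ (∑ j ∈ S, j) = 0 := by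
  have h1 : ∑ S ∈ Finset.powersetCard r (Finset.Ico lo (lo + L)), x ^ (∑ j ∈ S, j) =
      (∏ j ∈ Finset.Ico lo (lo + L),
        (1 + Polynomial.C (x ^ j) * Polynomial.X)).coeff r := by
    rw [Finset.prod_one_add, Polynomial.finsetSum_coeff, Finset.powersetCard_eq_filter,
      Finset.sum_filter]
    refine Finset.sum_congr rfl fun S _ => ?_
    rw [Finset.prod_mul_distrib, Finset.prod_const, ← map_prod, Polynomial.coeff_C_mul_X_pow,
      Finset.prod_pow_eq_pow_sum]
    simp [eq_comm]
  rw [h1, ← Finset.prod_Ico_consecutive _ (show lo ≤ lo + p by omega)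
    (show lo + p ≤ lo + L by omega), Polynomial.coeff_mul]
  refine Finset.sum_eq_zero fun kl hkl => ?_
  rw [Finset.HasAntidiagonal.mem_antidiagonal] at hkl
  rcases eq_or_ne kl.1 0 with h0 | h0
  · have hdeg : (∏ j ∈ Finset.Ico (lo + p) (lo + L),
        (1 + Polynomial.C (x ^ j) * Polynomial.X)).natDegree ≤ L - p := by
      refine (Polynomial.natDegree_prod_le _ _).trans ?_
      refine (Finset.sum_le_card_nsmul _ _ 1 fun j _ => ?_).trans ?_
      · compute_degree
      · simp
        omega
    rw [Polynomial.coeff_eq_zero_of_natDegree_lt (hdeg.trans_lt (by omega)), mul_zero]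
  · rw [coeff_prod_one_add_eq_zero hx lo _ h0 (by omega), zero_mul]

/-- Summing over a finset a function of the number of larger elements. -/
theorem sum_card_filter_gt {ι M : Type*} [LinearOrder ι] [AddCommMonoid M]
    (f : ℕ → M) (S : Finset ι) :
    ∑ i ∈ S, f (S.filter fun j => i < j).card = ∑ r ∈ Finset.range S.card, f r := by
  induction S using Finset.induction_on_min with
  | empty => simp
  | insert a s ha ih =>
    have hnot : a ∉ s := fun h => lt_irrefl _ (ha a h)
    rw [Finset.sum_insert hnot, Finset.card_insert_of_notMem hnot, Finset.sum_range_succ, ← ih,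
      add_comm]
    congr 1
    · refine Finset.sum_congr rfl fun i hi => ?_
      rw [Finset.filter_insert, if_neg (ha i hi).not_gt]
    · rw [Finset.filter_insert, if_neg (lt_irrefl a), Finset.filter_true_of_mem ha]

/-- Summing over a finset a function of the number of smaller elements. -/
theorem sum_card_filter_lt {ι M : Type*} [LinearOrder ι] [AddCommMonoid M]
    (f : ℕ → M) (S : Finset ι) :
    ∑ i ∈ S, f (S.filter fun j => j < i).card = ∑ r ∈ Finset.range S.card, f r :=
  sum_card_filter_gt (ι := ιᵒᵈ) f S

theorem mem_onesOf {z : ℕ} (s : Str z) (j : Fin z) : j ∈ onesOf s ↔ s j = 1 := by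
  simp [onesOf]

theorem onesOf_update_one {z : ℕ} (t : Str z) (i : Fin z) :
    onesOf (Function.update t i 1) = insert i (onesOf t) := by
  ext j
  by_cases h : j = i <;> simp [mem_onesOf, h]

theorem onesOf_update_zero {z : ℕ} (t : Str z) (i : Fin z) :
    onesOf (Function.update t i 0) = (onesOf t).erase i := by
  ext j
  by_cases h : j = i <;> simp [mem_onesOf, h]

theorem sum_ite_update {z : ℕ} (t : Str z) (i : Fin z) (a b : Fin 2)
    (f : Str z → ℂ) :
    (∑ s : Str z, if s i = a ∧ t = Function.update s i b then f s else 0) =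
      if t i = b then f (Function.update t i a) else 0 := by
  have key : ∀ s : Str z, (s i = a ∧ t = Function.update s i b) ↔
      (t i = b ∧ s = Function.update t i a) := by
    intro s
    constructor
    · rintro ⟨h1, rfl⟩
      simp [← h1]
    · rintro ⟨h1, rfl⟩
      simp [← h1]
  simp only [key]
  by_cases h : t i = b <;> simp [h]

theorem kwt_eq_one_sub (v : Fin 2) : kwt v = 1 - 2 * (if v = 1 then 1 else 0) := by
  fin_cases v <;> simp [kwt]

theorem kwt_eq_sub_one (v : Fin 2) : kwt v = 2 * (if v = 0 then 1 else 0) - 1 := by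
  fin_cases v <;> simp [kwt]

theorem EOp_apply {q : ℂ} {z : ℕ} (v : Vz z) (t : Str z) :
    EOp q z v t = ∑ i : Fin z, if t i = 0 then
      q ^ (∑ j ∈ Finset.univ.filter (fun j => i < j), kwt (t j)) * v (Function.update t i 1)
      else 0 := by
  simp only [EOp, Matrix.mulVecLin_apply, Matrix.mulVec, dotProduct, Emat, Finset.sum_mul]
  rw [Finset.sum_comm]
  refine Finset.sum_congr rfl fun i _ => ?_
  simp only [ite_mul, zero_mul]
  rw [sum_ite_update t i _ _
    fun s => q ^ (∑ j ∈ Finset.univ.filter (fun j => i < j), kwt (s j)) * v s]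
  refine if_congr Iff.rfl ?_ rfl
  congr 2
  refine Finset.sum_congr rfl fun j hj => ?_
  rw [Function.update_of_ne (Finset.mem_filter.mp hj).2.ne']

theorem FOp_apply {q : ℂ} {z : ℕ} (v : Vz z) (t : Str z) :
    FOp q z v t = ∑ i : Fin z, if t i = 1 then
      q ^ (-∑ j ∈ Finset.univ.filter (fun j => j < i), kwt (t j)) * v (Function.update t i 0)
      else 0 := by
  simp only [FOp, Matrix.mulVecLin_apply, Matrix.mulVec, dotProduct, Fmat, Finset.sum_mul]
  rw [Finset.sum_comm]
  refine Finset.sum_congr rfl fun i _ => ?_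
  simp only [ite_mul, zero_mul]
  rw [sum_ite_update t i _ _
    fun s => q ^ (-∑ j ∈ Finset.univ.filter (fun j => j < i), kwt (s j)) * v s]
  refine if_congr Iff.rfl ?_ rfl
  congr 3
  refine Finset.sum_congr rfl fun j hj => ?_
  rw [Function.update_of_ne (Finset.mem_filter.mp hj).2.ne]

theorem card_filter_eq_zero {z : ℕ} (t : Str z) :
    (Finset.univ.filter fun j => t j = 0).card + (onesOf t).card = z := by
  have h := Finset.card_filter_add_card_filter_not (s := (Finset.univ : Finset (Fin z)))
    (fun j => t j = 0)
  rw [Finset.card_univ, Fintype.card_fin] at h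
  have h2 : onesOf t = Finset.univ.filter fun j => ¬ t j = 0 := by
    ext j
    simp only [mem_onesOf, Finset.mem_filter, Finset.mem_univ, true_and]
    omega
  rw [h2, h]

theorem sum_kwt_gt {z : ℕ} (t : Str z) (i : Fin z) :
    ∑ j ∈ Finset.univ.filter (fun j => i < j), kwt (t j) =
      2 * ((((Finset.univ.filter fun j => t j = 0).filter fun j => i < j).card : ℕ) : ℤ)
        - (z - 1 - i) := by
  have h := Fin.card_Ioi i
  have h2 : (Finset.univ.filter fun j => i < j) = Finset.Ioi i := by ext; simp
  simp only [kwt_eq_sub_one, Finset.sum_sub_distrib, ← Finset.mul_sum, Finset.sum_boole,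
    Finset.sum_const,
    Finset.filter_filter, and_comm]
  rw [h2, h]
  have := i.isLt
  push_cast [nsmul_eq_mul, Nat.sub_sub, Nat.cast_sub (show 1 + (i : ℕ) ≤ z by omega)]
  ring

theorem sum_kwt_lt {z : ℕ} (t : Str z) (i : Fin z) :
    ∑ j ∈ Finset.univ.filter (fun j => j < i), kwt (t j) =
      i - 2 * ((((onesOf t).filter fun j => j < i).card : ℕ) : ℤ) := by
  have h := Fin.card_Iio i
  have h2 : (Finset.univ.filter fun j => j < i) = Finset.Iio i := by ext; simp
  simp only [kwt_eq_one_sub, Finset.sum_sub_distrib, ← Finset.mul_sum, Finset.sum_boole,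
    Finset.sum_const,
    onesOf, Finset.filter_filter, and_comm]
  rw [h2, h]
  simp

/-- `E_z^m x_{z,z}` is, up to a scalar, the sum of all `ρ_S` with `|S| = z - m`, weighted by
`q^{-Σ S}`. -/
theorem EOp_pow_xtop {q : ℂ} (hq : q ≠ 0) (z m : ℕ) : ∃ C : ℂ, ∀ t : Str z,
    (EOp q z ^ m) (xtop z) t =
      if (onesOf t).card + m = z then C * q ^ (-posSum (onesOf t)) else 0 := by
  induction m with
  | zero =>
    refine ⟨q ^ posSum (Finset.univ : Finset (Fin z)), fun t => ?_⟩
    have hiff : (onesOf t).card + 0 = z ↔ onesOf t = Finset.univ := by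
      rw [← Finset.card_eq_iff_eq_univ, Fintype.card_fin, add_zero]
    have hiff2 : (t = fun j => if j ∈ (Finset.univ : Finset (Fin z)) then 1 else 0) ↔
        onesOf t = Finset.univ := by
      simp [funext_iff, Finset.eq_univ_iff_forall, mem_onesOf]
    simp only [pow_zero, Module.End.one_apply, xtop, rho, hiff, hiff2]
    split_ifs with h
    · rw [h, ← zpow_add₀ hq, add_neg_cancel, zpow_zero]
    · rfl
  | succ m ih =>
    obtain ⟨C, hC⟩ := ih
    refine ⟨C * (q ^ (-(z : ℤ)) * ∑ r ∈ Finset.range (m + 1), (q ^ 2) ^ r), fun t => ?_⟩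
    rw [pow_succ', Module.End.mul_apply, EOp_apply]
    have hterm : ∀ i : Fin z, t i = 0 →
        q ^ (∑ j ∈ Finset.univ.filter (fun j => i < j), kwt (t j)) *
          (EOp q z ^ m) (xtop z) (Function.update t i 1) =
        if (onesOf t).card + (m + 1) = z then C * q ^ (-posSum (onesOf t)) * (q ^ (-(z : ℤ)) *
          (q ^ 2) ^ ((Finset.univ.filter fun j => t j = 0).filter fun j => i < j).card)
        else 0 := by
      intro i hi
      have hmem : i ∉ onesOf t := by simp [mem_onesOf, hi]
      rw [hC, onesOf_update_one, Finset.card_insert_of_notMem hmem, sum_kwt_gt,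
        show (onesOf t).card + 1 + m = (onesOf t).card + (m + 1) by ring]
      split_ifs
      · rw [posSum, Finset.sum_insert hmem, ← posSum, ← pow_mul, ← zpow_natCast q]
        have : ∀ a b c d e : ℤ, a + b = c + (d + e) →
            q ^ a * (C * q ^ b) = C * q ^ c * (q ^ d * q ^ e) := by
          intro a b c d e h
          rw [mul_assoc, ← zpow_add₀ hq, ← zpow_add₀ hq, ← h, zpow_add₀ hq]
          ring
        apply this
        push_cast
        ring
      · rw [mul_zero]
    rw [← Finset.sum_filter, Finset.sum_congr rfl fun i hi => hterm i (Finset.mem_filter.mp hi).2]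
    split_ifs with h
    · have hz := card_filter_eq_zero t
      rw [← Finset.mul_sum, ← Finset.mul_sum,
        sum_card_filter_gt (fun r => (q ^ 2) ^ r),
        show (Finset.univ.filter fun j => t j = 0).card = m + 1 by omega]
      ring
    · simp

/-- `F_z^m x_{0,z}` is, up to a scalar, the sum of all `ρ_S` with `|S| = m`, weighted by
`q^{-Σ S}`. -/
theorem FOp_pow_x0 {q : ℂ} (hq : q ≠ 0) (z m : ℕ) : ∃ C : ℂ, ∀ t : Str z,
    (FOp q z ^ m) (x0 z) t =
      if (onesOf t).card = m then C * q ^ (-posSum (onesOf t)) else 0 := by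
  induction m with
  | zero =>
    refine ⟨1, fun t => ?_⟩
    have hiff2 : (t = fun j => if j ∈ (∅ : Finset (Fin z)) then 1 else 0) ↔ onesOf t = ∅ := by
      simp only [funext_iff, Finset.eq_empty_iff_forall_notMem, mem_onesOf, Finset.notMem_empty,
        if_false]
      exact forall_congr' fun j => by omega
    simp only [pow_zero, Module.End.one_apply, x0, rho, Finset.card_eq_zero, hiff2]
    split_ifs with h
    · simp [h, posSum]
    · rfl
  | succ m ih =>
    obtain ⟨C, hC⟩ := ih
    refine ⟨C * (q * ∑ r ∈ Finset.range (m + 1), (q ^ 2) ^ r), fun t => ?_⟩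
    rw [pow_succ', Module.End.mul_apply, FOp_apply]
    have hterm : ∀ i : Fin z, t i = 1 →
        q ^ (-∑ j ∈ Finset.univ.filter (fun j => j < i), kwt (t j)) *
          (FOp q z ^ m) (x0 z) (Function.update t i 0) =
        if (onesOf t).card = m + 1 then C * q ^ (-posSum (onesOf t)) * (q *
          (q ^ 2) ^ ((onesOf t).filter fun j => j < i).card) else 0 := by
      intro i hi
      have hmem : i ∈ onesOf t := by simp [mem_onesOf, hi]
      have hcard := Finset.card_erase_add_one hmem
      have hsum : posSum ((onesOf t).erase i) + (((i : ℕ) : ℤ) + 1) = posSum (onesOf t) :=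
        Finset.sum_erase_add _ _ hmem
      rw [hC, onesOf_update_zero, sum_kwt_lt, ← hcard, ← hsum]
      simp only [add_left_inj]
      split_ifs
      · rw [← pow_mul, ← zpow_natCast q]
        have : ∀ a b c e : ℤ, a + b = c + (1 + e) →
            q ^ a * (C * q ^ b) = C * q ^ c * (q * q ^ e) := by
          intro a b c e h
          have h2 : q ^ a * q ^ b = q ^ c * (q * q ^ e) := by
            rw [← zpow_one_add₀ hq, ← zpow_add₀ hq, ← zpow_add₀ hq, h]
          linear_combination C * h2
        apply this
        push_cast
        ring
      · rw [mul_zero]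
    rw [← Finset.sum_filter, Finset.sum_congr rfl fun i hi => hterm i (Finset.mem_filter.mp hi).2]
    split_ifs with h
    · rw [← Finset.mul_sum, ← Finset.mul_sum, ← onesOf,
        sum_card_filter_lt (fun r => (q ^ 2) ^ r), h]
      ring
    · simp

/-- The positions in the window `[a, a + c)` at which `t` carries `ν₁`. -/
def windowOnes {n : ℕ} (a c : ℕ) (t : Str n) : Finset (Fin n) :=
  Finset.univ.filter fun j => (a ≤ (j : ℕ) ∧ (j : ℕ) < a + c) ∧ t j = 1

/-- The inclusion of a window of length `c` starting at `a` into `Fin n`. -/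
def windowEmb {n a c : ℕ} (h : a + c ≤ n) : Fin c ↪ Fin n where
  toFun j := ⟨a + (j : ℕ), by have := j.isLt; omega⟩
  inj' x y hxy := by simpa [Fin.ext_iff] using hxy

theorem val_windowEmb {n a c : ℕ} (h : a + c ≤ n) (j : Fin c) :
    (windowEmb h j : ℕ) = a + (j : ℕ) :=
  rfl

theorem windowOnes_eq_map {n a c : ℕ} (h : a + c ≤ n) (t : Str n) :
    windowOnes a c t = (onesOf fun j : Fin c => t (windowEmb h j)).map (windowEmb h) := by
  ext j
  simp only [windowOnes, Finset.mem_filter, Finset.mem_univ, true_and, Finset.mem_map, mem_onesOf]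
  constructor
  · rintro ⟨⟨h1, h2⟩, h3⟩
    have hj : windowEmb h ⟨(j : ℕ) - a, by omega⟩ = j := Fin.ext (by simp [val_windowEmb]; omega)
    exact ⟨⟨(j : ℕ) - a, by omega⟩, by rwa [hj], hj⟩
  · rintro ⟨x, hx, rfl⟩
    exact ⟨⟨by simp [val_windowEmb], by simp [val_windowEmb]⟩, hx⟩

theorem card_onesOf_window {n a c : ℕ} (h : a + c ≤ n) (t : Str n) :
    (onesOf fun j : Fin c => t (windowEmb h j)).card = (windowOnes a c t).card := by
  rw [windowOnes_eq_map h, Finset.card_map]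

theorem posSum_onesOf_window {n a c : ℕ} (h : a + c ≤ n) (t : Str n) :
    posSum (onesOf fun j : Fin c => t (windowEmb h j)) =
      ((∑ j ∈ windowOnes a c t, (j : ℕ) : ℕ) : ℤ) - ((a : ℤ) - 1) * (windowOnes a c t).card := by
  rw [windowOnes_eq_map h, Finset.card_map, Finset.sum_map, posSum]
  simp only [val_windowEmb]
  push_cast
  rw [Finset.sum_add_distrib, Finset.sum_add_distrib, Finset.sum_const, Finset.sum_const]
  simp only [nsmul_eq_mul]
  ring

/-- Strings agreeing with `t₀` off `O` are parametrized by the subsets of `O`. -/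
theorem sum_filter_agree {n : ℕ} (O : Finset (Fin n)) (t₀ : Str n) (f : Str n → ℂ) :
    ∑ t ∈ Finset.univ.filter (fun t : Str n => ∀ j ∉ O, t j = t₀ j), f t =
      ∑ S ∈ O.powerset, f fun j => if j ∈ O then (if j ∈ S then 1 else 0) else t₀ j := by
  symm
  refine Finset.sum_bij' (fun S _ => fun j => if j ∈ O then (if j ∈ S then 1 else 0) else t₀ j)
    (fun t _ => O.filter fun j => t j = 1) ?_ ?_ ?_ ?_ ?_
  · intro S _
    simp +contextual
  · intro t _
    simp
  · intro S hS
    ext j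
    have hSO : S ⊆ O := Finset.mem_powerset.mp hS
    have := @hSO j
    by_cases hO : j ∈ O <;> by_cases hj : j ∈ S <;> simp_all
  · intro t ht
    have ht := (Finset.mem_filter.mp ht).2
    funext j
    by_cases hO : j ∈ O
    · simp only [hO, if_true, Finset.mem_filter, true_and]
      split_ifs <;> omega
    · simp [hO, ht j hO]
  · intro S _
    rfl

theorem windowOnes_of_subset {n a c : ℕ} {O S : Finset (Fin n)} (t₀ : Str n)
    (hO : ∀ j ∈ O, a ≤ (j : ℕ) ∧ (j : ℕ) < a + c) (hS : S ⊆ O) :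
    windowOnes a c (fun j => if j ∈ O then (if j ∈ S then 1 else 0) else t₀ j) =
        S ∪ windowOnes a c t₀ \ O ∧ Disjoint S (windowOnes a c t₀ \ O) := by
  refine ⟨?_, Finset.disjoint_of_subset_left hS Finset.disjoint_sdiff⟩
  ext j
  have h1 := @hS j
  have h2 := hO j
  simp only [windowOnes, Finset.mem_filter, Finset.mem_univ, true_and, Finset.mem_union,
    Finset.mem_sdiff]
  by_cases hjO : j ∈ O <;> by_cases hjS : j ∈ S <;> simp_all

theorem sum_powersetCard_fin_pow_eq_zero {x : ℂ} {p : ℕ} (hx : IsPrimitiveRoot x p)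
    {n lo hi r : ℕ} (hin : hi ≤ n) (hpL : p ≤ hi - lo) (hr : r < p) (hL : hi - lo < r + p)
    (hlohi : lo ≤ hi) :
    ∑ S ∈ Finset.powersetCard r
      (Finset.univ.filter fun j : Fin n => lo ≤ (j : ℕ) ∧ (j : ℕ) < hi),
      x ^ (∑ j ∈ S, (j : ℕ)) = 0 := by
  have h := sum_powersetCard_Ico_pow_eq_zero hx (lo := lo) hpL hr hL
  have hmap : Finset.Ico lo (lo + (hi - lo)) =
      (Finset.univ.filter fun j : Fin n => lo ≤ (j : ℕ) ∧ (j : ℕ) < hi).map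
        Fin.valEmbedding := by
    ext k
    simp only [Finset.mem_Ico, Finset.mem_map, Finset.mem_filter, Finset.mem_univ, true_and,
      Fin.valEmbedding_apply]
    constructor
    · rintro ⟨h1, h2⟩
      exact ⟨⟨k, by omega⟩, ⟨h1, by simp; omega⟩, rfl⟩
    · rintro ⟨j, ⟨h1, h2⟩, rfl⟩
      omega
  rw [hmap, Finset.powersetCard_map, Finset.sum_map] at h
  simpa using h

/-- Two overlapping amplifications of weight-graded matrices with entries proportional to
`q^{-Σ - Σ}` compose to zero when the gradings force the overlap sum to be a vanishing Gaussian
binomial. -/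
theorem ampMat_mul_ampMat_eq_zero {q : ℂ} (hq0 : q ≠ 0) {p : ℕ}
    (hq : IsPrimitiveRoot (q ^ 2)⁻¹ p) {n a b : ℕ} (ha : a + (2 * p - 1) ≤ n)
    (hb : b + (2 * p - 1) ≤ n) (hab : a < b + p) (hba : b < a + p)
    {M : Matrix (Str (2 * p - 1)) (Str (2 * p - 1)) ℂ} {g : ℕ → ℕ → ℂ}
    (hM : ∀ t s, M t s = g (onesOf t).card (onesOf s).card *
      (q ^ (-posSum (onesOf t)) * q ^ (-posSum (onesOf s))))
    (hg : ∀ l k l' k', g l k ≠ 0 → g l' k' ≠ 0 → (k < p ∧ p ≤ l') ∨ (p ≤ k ∧ l' < p)) :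
    ampMat n a (2 * p - 1) ha M * ampMat n b (2 * p - 1) hb M = 0 := by
  ext u s
  rw [Matrix.mul_apply, Matrix.zero_apply]
  simp only [ampMat, ite_mul, mul_ite, mul_zero, zero_mul, ← ite_and]
  rw [← Finset.sum_filter]
  set O : Finset (Fin n) := Finset.univ.filter fun j : Fin n =>
    max a b ≤ (j : ℕ) ∧ (j : ℕ) < min a b + (2 * p - 1) with hO
  by_cases hex : ∃ t₀ : Str n,
      (∀ j : Fin n, ((j : ℕ) < a ∨ a + (2 * p - 1) ≤ (j : ℕ)) → u j = t₀ j) ∧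
      (∀ j : Fin n, ((j : ℕ) < b ∨ b + (2 * p - 1) ≤ (j : ℕ)) → t₀ j = s j)
  swap
  · refine Finset.sum_eq_zero fun t ht => absurd ⟨t, ?_⟩ hex
    have := (Finset.mem_filter.mp ht).2
    tauto
  obtain ⟨t₀, hu, hs⟩ := hex
  have hfilter : (Finset.univ.filter fun t : Str n =>
      (∀ j : Fin n, ((j : ℕ) < b ∨ b + (2 * p - 1) ≤ (j : ℕ)) → t j = s j) ∧
      (∀ j : Fin n, ((j : ℕ) < a ∨ a + (2 * p - 1) ≤ (j : ℕ)) → u j = t j)) =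
      Finset.univ.filter fun t : Str n => ∀ j ∉ O, t j = t₀ j := by
    refine Finset.filter_congr fun t _ => ⟨fun ht j hj => ?_, fun ht => ⟨fun j hj => ?_,
      fun j hj => ?_⟩⟩
    · have hj : ¬ (max a b ≤ (j : ℕ) ∧ (j : ℕ) < min a b + (2 * p - 1)) := by
        simpa [hO] using hj
      by_cases hja : (j : ℕ) < a ∨ a + (2 * p - 1) ≤ (j : ℕ)
      · rw [← ht.2 j hja, hu j hja]
      · have hjb : (j : ℕ) < b ∨ b + (2 * p - 1) ≤ (j : ℕ) := by omega
        rw [ht.1 j hjb, hs j hjb]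
    · rw [ht j, hs j hj]
      simp only [hO, Finset.mem_filter, Finset.mem_univ, true_and]
      omega
    · rw [ht j, hu j hj]
      simp only [hO, Finset.mem_filter, Finset.mem_univ, true_and]
      omega
  have hterm : ∀ t : Str n,
      M (fun j => u (windowEmb ha j)) (fun j => t (windowEmb ha j)) *
        M (fun j => t (windowEmb hb j)) (fun j => s (windowEmb hb j)) =
      g (windowOnes a (2 * p - 1) u).card (windowOnes a (2 * p - 1) t).card *
        g (windowOnes b (2 * p - 1) t).card (windowOnes b (2 * p - 1) s).card *
      (q ^ (-posSum (onesOf fun j => u (windowEmb ha j))) *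
        q ^ (-posSum (onesOf fun j => s (windowEmb hb j))) *
        q ^ (-(((∑ j ∈ windowOnes a (2 * p - 1) t, (j : ℕ) : ℕ) : ℤ) -
          ((a : ℤ) - 1) * (windowOnes a (2 * p - 1) t).card)) *
        q ^ (-(((∑ j ∈ windowOnes b (2 * p - 1) t, (j : ℕ) : ℕ) : ℤ) -
          ((b : ℤ) - 1) * (windowOnes b (2 * p - 1) t).card))) := by
    intro t
    rw [hM, hM, ← posSum_onesOf_window ha, ← posSum_onesOf_window hb]
    simp only [card_onesOf_window]
    ring
  change ∑ t : Str n with _,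
    M (fun j => u (windowEmb ha j)) (fun j => t (windowEmb ha j)) *
      M (fun j => t (windowEmb hb j)) (fun j => s (windowEmb hb j)) = 0
  simp only [hterm]
  rw [hfilter, sum_filter_agree, Finset.sum_powerset]
  refine Finset.sum_eq_zero fun r _ => ?_
  have hOa : ∀ j ∈ O, a ≤ (j : ℕ) ∧ (j : ℕ) < a + (2 * p - 1) := by
    intro j hj
    simp only [hO, Finset.mem_filter, Finset.mem_univ, true_and] at hj
    omega
  have hOb : ∀ j ∈ O, b ≤ (j : ℕ) ∧ (j : ℕ) < b + (2 * p - 1) := by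
    intro j hj
    simp only [hO, Finset.mem_filter, Finset.mem_univ, true_and] at hj
    omega
  have hcard : ∀ c : ℕ, c = a ∨ c = b →
      (windowOnes c (2 * p - 1) t₀ \ O).card ≤ max a b - min a b := by
    intro c hc
    have hsub : (windowOnes c (2 * p - 1) t₀ \ O).map Fin.valEmbedding ⊆
        if c = max a b then Finset.Ico (min a b + (2 * p - 1)) (max a b + (2 * p - 1))
        else Finset.Ico (min a b) (max a b) := by
      intro k hk
      simp only [windowOnes, hO, Finset.mem_map, Finset.mem_sdiff, Finset.mem_filter,
        Finset.mem_univ, true_and, Fin.valEmbedding_apply] at hk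
      obtain ⟨j, ⟨⟨h1, -⟩, h2⟩, rfl⟩ := hk
      split_ifs <;> (rw [Finset.mem_Ico]; omega)
    have := Finset.card_le_card hsub
    rw [Finset.card_map] at this
    refine this.trans ?_
    split_ifs <;> simp <;> omega
  set A := windowOnes a (2 * p - 1) t₀ \ O with hA
  set B := windowOnes b (2 * p - 1) t₀ \ O with hB
  have hAc : A.card ≤ max a b - min a b := hcard a (Or.inl rfl)
  have hBc : B.card ≤ max a b - min a b := hcard b (Or.inr rfl)
  set gu := g (windowOnes a (2 * p - 1) u).card (r + A.card)
  set gs := g (r + B.card) (windowOnes b (2 * p - 1) s).card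
  have hsum : ∀ f : Finset (Fin n) → ℂ, (∀ S ∈ Finset.powersetCard r O, f S =
      gu * gs * (q ^ (-posSum (onesOf fun j => u (windowEmb ha j))) *
        q ^ (-posSum (onesOf fun j => s (windowEmb hb j))) *
        q ^ (-(((∑ j ∈ A, (j : ℕ) : ℕ) : ℤ) - ((a : ℤ) - 1) * ((r + A.card : ℕ) : ℤ))) *
        q ^ (-(((∑ j ∈ B, (j : ℕ) : ℕ) : ℤ) - ((b : ℤ) - 1) * ((r + B.card : ℕ) : ℤ)))) *
        (q ^ 2)⁻¹ ^ (∑ j ∈ S, (j : ℕ))) → ∑ S ∈ Finset.powersetCard r O, f S = 0 := by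
    intro f hf
    rw [Finset.sum_congr rfl hf, ← Finset.mul_sum]
    by_cases hgus : gu = 0 ∨ gs = 0
    · rcases hgus with h | h <;> simp [h]
    · have hr := hg _ _ _ _ (fun h => hgus (Or.inl h)) (fun h => hgus (Or.inr h))
      rw [hO, sum_powersetCard_fin_pow_eq_zero hq, mul_zero] <;> omega
  refine hsum _ fun S hS => ?_
  obtain ⟨hSO, hSr⟩ := Finset.mem_powersetCard.mp hS
  obtain ⟨ha1, ha2⟩ := windowOnes_of_subset t₀ hOa hSO
  obtain ⟨hb1, hb2⟩ := windowOnes_of_subset t₀ hOb hSO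
  rw [ha1, hb1, ← hA, ← hB, Finset.card_union_of_disjoint ha2, Finset.card_union_of_disjoint hb2,
    Finset.sum_union ha2, Finset.sum_union hb2, hSr]
  have hpow : (q ^ 2)⁻¹ ^ (∑ j ∈ S, (j : ℕ)) =
      q ^ (-((∑ j ∈ S, (j : ℕ) : ℕ) : ℤ)) * q ^ (-((∑ j ∈ S, (j : ℕ) : ℕ) : ℤ)) := by
    rw [zpow_neg, zpow_natCast, ← mul_inv, ← mul_pow, inv_pow, sq]
  have hsplit : ∀ x y z : ℤ, q ^ (-(x + y - z)) = q ^ (-x) * q ^ (-(y - z)) := by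
    intro x y z
    rw [← zpow_add₀ hq0]
    congr 1
    ring
  rw [hpow, Nat.cast_add (∑ j ∈ S, (j : ℕ)), Nat.cast_add (∑ j ∈ S, (j : ℕ)), hsplit, hsplit]
  ring

/-- The entries of `α` are proportional to `q^{-Σ - Σ}`, with a factor depending only on the numbers
of letters `ν₁` in the row and column strings. -/
theorem alphaMat_eq {q : ℂ} (hq : q ≠ 0) {p : ℕ} (hp : 2 ≤ p) : ∃ g : ℕ → ℕ → ℂ,
    (∀ l k, g l k ≠ 0 → k < p ∧ p ≤ l) ∧
    ∀ t s, alphaMat q p t s = g (onesOf t).card (onesOf s).card *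
      (q ^ (-posSum (onesOf t)) * q ^ (-posSum (onesOf s))) := by
  choose C hC using fun m => EOp_pow_xtop hq (2 * p - 1) m
  refine ⟨fun l k => if k < p ∧ l + (p - 1 - k) = 2 * p - 1 then
    q ^ ((k : ℤ) * ((2 * p - 1 : ℕ) : ℤ) - ((k : ℤ) ^ 2 - (k : ℤ)) / 2) * qfact q k *
      C (p - 1 - k) else 0, fun l k h => ?_, fun t s => ?_⟩
  · have := (ite_ne_right_iff.mp h).1
    omega
  · simp only [alphaMat, hC, ite_and]
    split_ifs
    · rw [sub_eq_add_neg _ (posSum (onesOf s)), zpow_add₀ hq]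
      ring
    · ring
    · ring

/-- The entries of `β` are proportional to `q^{-Σ - Σ}`, with a factor depending only on the numbers
of letters `ν₁` in the row and column strings. -/
theorem betaMat_eq {q : ℂ} (hq : q ≠ 0) {p : ℕ} (hp : 2 ≤ p) : ∃ g : ℕ → ℕ → ℂ,
    (∀ l k, g l k ≠ 0 → p ≤ k ∧ l < p) ∧
    ∀ t s, betaMat q p t s = g (onesOf t).card (onesOf s).card *
      (q ^ (-posSum (onesOf t)) * q ^ (-posSum (onesOf s))) := by
  choose C hC using fun m => FOp_pow_x0 hq (2 * p - 1) m
  refine ⟨fun l k => if k ≤ 2 * p - 1 ∧ p ≤ k ∧ l = k - p then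
    q ^ ((k : ℤ) * ((2 * p - 1 : ℕ) : ℤ) - ((k : ℤ) ^ 2 - (k : ℤ)) / 2) *
      qfact q (2 * p - 1 - k) * C (k - p) else 0, fun l k h => ?_, fun t s => ?_⟩
  · have := (ite_ne_right_iff.mp h).1
    omega
  · have hle : (onesOf s).card ≤ 2 * p - 1 := by
      simpa using Finset.card_le_univ (onesOf s)
    simp only [betaMat, hC, ite_and, hle, if_true]
    split_ifs
    · rw [sub_eq_add_neg _ (posSum (onesOf s)), zpow_add₀ hq]
      ring
    · ring
    · ring

/-- for `1 ≤ i, j ≤ n - 2p + 2` with `|i - j| < p`,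
`αᵢ∘αⱼ = αⱼ∘αᵢ = 0` and `βᵢ∘βⱼ = βⱼ∘βᵢ = 0` on `V^{⊗n}`.
(The bound `i ≤ n - 2p + 2` is written as `i + 2p ≤ n + 2` to avoid truncated
natural subtraction.) -/
theorem stmt2 (p : ℕ) (hp : 2 ≤ p) (q : ℂ)
    (hq : q = Complex.exp (Real.pi * Complex.I / p))
    (n : ℕ) (hn : 2 * p - 1 ≤ n)
    (i j : ℕ) (hi1 : 1 ≤ i) (hj1 : 1 ≤ j)
    (hi2 : i + 2 * p ≤ n + 2) (hj2 : j + 2 * p ≤ n + 2)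
    (hij : |(i : ℤ) - (j : ℤ)| < (p : ℤ)) :
    alphaOpAt q p n i (by omega) ∘ₗ alphaOpAt q p n j (by omega) = 0 ∧
      alphaOpAt q p n j (by omega) ∘ₗ alphaOpAt q p n i (by omega) = 0 ∧
      betaOpAt q p n i (by omega) ∘ₗ betaOpAt q p n j (by omega) = 0 ∧
      betaOpAt q p n j (by omega) ∘ₗ betaOpAt q p n i (by omega) = 0 := by
  have hq0 : q ≠ 0 := hq ▸ Complex.exp_ne_zero _
  have hprim : IsPrimitiveRoot (q ^ 2)⁻¹ p := by
    have h : q ^ 2 = Complex.exp (2 * Real.pi * Complex.I / p) := by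
      rw [hq, ← Complex.exp_nat_mul]
      congr 1
      push_cast
      ring
    rw [h]
    exact (Complex.isPrimitiveRoot_exp p (by omega)).inv
  rw [abs_lt] at hij
  obtain ⟨g, hg, hα⟩ := alphaMat_eq hq0 hp
  obtain ⟨g', hg', hβ⟩ := betaMat_eq hq0 hp
  simp only [alphaOpAt, betaOpAt, ← Matrix.mulVecLin_mul]
  refine ⟨?_, ?_, ?_, ?_⟩
  · rw [ampMat_mul_ampMat_eq_zero hq0 hprim _ _ (by omega) (by omega) hα
      fun l k l' k' h h' => Or.inl ⟨(hg _ _ h).1, (hg _ _ h').2⟩, Matrix.mulVecLin_zero]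
  · rw [ampMat_mul_ampMat_eq_zero hq0 hprim _ _ (by omega) (by omega) hα
      fun l k l' k' h h' => Or.inl ⟨(hg _ _ h).1, (hg _ _ h').2⟩, Matrix.mulVecLin_zero]
  · rw [ampMat_mul_ampMat_eq_zero hq0 hprim _ _ (by omega) (by omega) hβ
      fun l k l' k' h h' => Or.inr ⟨(hg' _ _ h).1, (hg' _ _ h').2⟩, Matrix.mulVecLin_zero]
  · rw [ampMat_mul_ampMat_eq_zero hq0 hprim _ _ (by omega) (by omega) hβ
      fun l k l' k' h h' => Or.inr ⟨(hg' _ _ h).1, (hg' _ _ h').2⟩, Matrix.mulVecLin_zero]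

end
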